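/- Testable implication of syntactic rule (2) of Theorem 5: let X, Z be partially observed random variables with missingness indicators R_X, R_Z and proxies X*, Z*, and let Y be a partially observed variable with missingness indicator R_Y. If X is conditionally independent of R_Y given (Z, R_X, R_Z), then for all values x, z and r ∈ {0,1} with P(R_Y = r, Z* = some z, R_X = 0, R_Z = 0) > 0 one has P(X* = some x | Z* = some z, R_X = 0, R_Z = 0) = P(X* = some x | R_Y = r, Z* = some z, R_X = 0, R_Z = 0); that is, the independence claim implies an identity expressed entirely in terms of the observed-data distribution. -/

import Mathlib

open MeasureTheory

/-- Elementary conditional probability `P(A | B)`. -/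
noncomputable def cpr {Ω : Type*} [MeasurableSpace Ω] (P : Measure Ω) (A B : Set Ω) : ENNReal :=
  P (A ∩ B) / P B

/-- Proxy variable: `X* = some X` when the indicator is `false` (observed, `R = 0`),
and `X* = none` when the indicator is `true` (missing, `R = 1`). -/
def proxy {Ω α : Type*} (X : Ω → α) (R : Ω → Bool) (ω : Ω) : Option α :=
  if R ω = false then some (X ω) else none

theorem ENNReal.div_eq_div_of_div_eq_mul_div {a b c d : ENNReal} (hb : b ≠ 0) (hb' : b ≠ ⊤)
    (hd : d ≠ 0) (hd' : d ≠ ⊤) (h : a / b = c / b * (d / b)) : c / b = a / d := by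
  rw [ENNReal.eq_div_iff hd hd', ← ENNReal.div_mul_cancel hb hb' (b := a), h, mul_assoc,
    ENNReal.div_mul_cancel hb hb', mul_comm]

theorem proxy_eq_some_iff {Ω α : Type*} {X : Ω → α} {R : Ω → Bool} {ω : Ω} {x : α} :
    proxy X R ω = some x ↔ R ω = false ∧ X ω = x := by
  simp [proxy]

/-- **Testable implication of syntactic rule (2) of Theorem 5.**
If `X ⟂ R_Y | (Z, R_X, R_Z)`, then for all `x, z` and `r` with
`P(R_Y = r, Z* = some z, R_X = 0, R_Z = 0) > 0`,
`P(X* = some x | Z* = some z, R_X = 0, R_Z = 0)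
  = P(X* = some x | R_Y = r, Z* = some z, R_X = 0, R_Z = 0)`,
an identity expressed entirely in terms of the observed-data distribution. -/
theorem testable_rule_two
    {Ω α β γ : Type*} [MeasurableSpace Ω]
    [Fintype α] [Nonempty α] [Fintype β] [Nonempty β] [Fintype γ] [Nonempty γ]
    (P : Measure Ω) [IsProbabilityMeasure P]
    (X : Ω → α) (Y : Ω → β) (Z : Ω → γ) (RX RY RZ : Ω → Bool)
    -- X is conditionally independent of RY given (Z, RX, RZ):
    (hCI : ∀ (x : α) (ry : Bool) (z : γ) (rx rz : Bool),
      cpr P ({ω | X ω = x} ∩ {ω | RY ω = ry})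
          {ω | Z ω = z ∧ RX ω = rx ∧ RZ ω = rz} =
        cpr P {ω | X ω = x} {ω | Z ω = z ∧ RX ω = rx ∧ RZ ω = rz} *
          cpr P {ω | RY ω = ry} {ω | Z ω = z ∧ RX ω = rx ∧ RZ ω = rz}) :
    ∀ (x : α) (z : γ) (r : Bool),
      0 < P {ω | RY ω = r ∧ proxy Z RZ ω = some z ∧ RX ω = false ∧ RZ ω = false} →
      cpr P {ω | proxy X RX ω = some x}
          {ω | proxy Z RZ ω = some z ∧ RX ω = false ∧ RZ ω = false} =
        cpr P {ω | proxy X RX ω = some x}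
          {ω | RY ω = r ∧ proxy Z RZ ω = some z ∧ RX ω = false ∧ RZ ω = false} := by
  intro x z r hpos
  have hB : {ω | proxy Z RZ ω = some z ∧ RX ω = false ∧ RZ ω = false} =
      {ω | Z ω = z ∧ RX ω = false ∧ RZ ω = false} := by
    ext ω
    simp only [Set.mem_ofPred_eq, proxy_eq_some_iff]
    tauto
  have hRB : {ω | RY ω = r ∧ proxy Z RZ ω = some z ∧ RX ω = false ∧ RZ ω = false} =
      {ω | RY ω = r} ∩ {ω | Z ω = z ∧ RX ω = false ∧ RZ ω = false} := by
    rw [← hB]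
    rfl
  have hXB : {ω | proxy X RX ω = some x} ∩ {ω | Z ω = z ∧ RX ω = false ∧ RZ ω = false} =
      {ω | X ω = x} ∩ {ω | Z ω = z ∧ RX ω = false ∧ RZ ω = false} := by
    ext ω
    simp only [Set.mem_inter_iff, Set.mem_ofPred_eq, proxy_eq_some_iff]
    tauto
  rw [hRB] at hpos
  have hXRB : {ω | proxy X RX ω = some x} ∩
      ({ω | RY ω = r} ∩ {ω | Z ω = z ∧ RX ω = false ∧ RZ ω = false}) =
      {ω | X ω = x} ∩ {ω | RY ω = r} ∩ {ω | Z ω = z ∧ RX ω = false ∧ RZ ω = false} := by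
    rw [Set.inter_left_comm, hXB, Set.inter_left_comm, Set.inter_assoc]
  rw [hB, hRB, cpr, cpr, hXB, hXRB]
  exact ENNReal.div_eq_div_of_div_eq_mul_div
    (hpos.trans_le (measure_mono Set.inter_subset_right)).ne' (measure_ne_top P _)
    hpos.ne' (measure_ne_top P _) (hCI x r z false false)
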